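/- Let s be a basic term and σ : V → T(C,V) a substitution into constructor terms. If s ≻epo* t, then N(sσ) ≻_{|t|} N(tσ), where |t| is the size of t. -/

import Mathlib

set_option maxHeartbeats 1000000

/-- First-order terms over a signature `F`, with variables drawn from `ℕ`. -/
inductive Tm (F : Type) : Type
  | var : ℕ → Tm F
  | fn  : F → List (Tm F) → Tm F

instance {F : Type} : Inhabited (Tm F) := ⟨Tm.var 0⟩

/-- The size `|t|` of a term. -/
def Tm.size {F} : Tm F → ℕ
  | .var _ => 1
  | .fn _ ts => 1 + (ts.attach.map fun t => t.1.size).sum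
decreasing_by have := List.sizeOf_lt_of_mem t.2; simp_wf; omega

/-- The depth of a term (variables and constants have depth 0). -/
def Tm.depth {F} : Tm F → ℕ
  | .var _ => 0
  | .fn _ [] => 0
  | .fn f (t :: ts) => max (t.depth + 1) (Tm.fn f ts).depth

/-- A (quasi-)precedence: a preorder `le` (i.e. `f ≿ g`) on the signature whose
strict part `≻` is well-founded. -/
structure Precedence (F : Type) where
  le : F → F → Prop
  refl : ∀ f, le f f
  trans : ∀ {f g h}, le f g → le g h → le f h
  wf : WellFounded (fun g f => le f g ∧ ¬ le g f)

/-- The strict part `f ≻ g` of a precedence. -/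
def Precedence.strict {F} (P : Precedence F) (f g : F) : Prop := P.le f g ∧ ¬ P.le g f

/-- The equivalence part `f ∼ g` of a precedence. -/
def Precedence.equiv {F} (P : Precedence F) (f g : F) : Prop := P.le f g ∧ P.le g f

/-- Term equivalence `s ≈ t` induced by the equivalence part of a precedence. -/
inductive TmEq {F} (P : Precedence F) : Tm F → Tm F → Prop
  | refl (t) : TmEq P t t
  | fn {f g : F} {ss ts : List (Tm F)} :
      P.equiv f g → ss.length = ts.length →
      (∀ i, i < ss.length → TmEq P (ss.getD i default) (ts.getD i default)) →
      TmEq P (.fn f ss) (.fn g ts)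

/-- `s` is a strict superterm of `t` modulo term equivalence `≈`. -/
inductive StrictSup {F} (P : Precedence F) : Tm F → Tm F → Prop
  | here {f : F} {ss : List (Tm F)} {s t : Tm F} :
      s ∈ ss → TmEq P s t → StrictSup P (.fn f ss) t
  | there {f : F} {ss : List (Tm F)} {s t : Tm F} :
      s ∈ ss → StrictSup P s t → StrictSup P (.fn f ss) t

mutual
/-- The order `a ≻_k b` (EPO) on finite sequences of terms, w.r.t. precedence
`P` and defined-symbol predicate `D`; terms are identified with singleton
sequences, `++` is concatenation. -/
inductive Epo {F} (P : Precedence F) (D : F → Bool) (k : ℕ) :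
    List (Tm F) → List (Tm F) → Prop
  /- (1) `a = f(s₁,…,s_m)` and `sᵢ (≻_k ∪ ≈) b` for some `i` -/
  | arg {f : F} {ss : List (Tm F)} {s : Tm F} {b : List (Tm F)} :
      s ∈ ss → EpoEq P D k [s] b → Epo P D k [Tm.fn f ss] b
  /- (2) `a = f(s₁,…,s_m)`, `f` defined, `b = [t₁ … t_n]` with `n = 0` or
     `2 ≤ n ≤ k`, and `a ≻_k t_j` for all `j` -/
  | seq {f : F} {ss ts : List (Tm F)} :
      D f = true →
      (ts.length = 0 ∨ (2 ≤ ts.length ∧ ts.length ≤ k)) →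
      (∀ t ∈ ts, Epo P D k [Tm.fn f ss] [t]) →
      Epo P D k [Tm.fn f ss] ts
  /- (3) `a = f(…)`, `f` defined, `b = g(t₁,…,t_n)` with `n ≤ k`, `f ≻ g`, and
     `a` is a strict superterm modulo `≈` of every `t_j` -/
  | prec {f g : F} {ss ts : List (Tm F)} :
      D f = true → P.strict f g → ts.length ≤ k →
      (∀ t ∈ ts, StrictSup P (Tm.fn f ss) t) →
      Epo P D k [Tm.fn f ss] [Tm.fn g ts]
  /- (4) `a = [s₁ … s_m]`, `b = b₁ ++ ⋯ ++ b_m`, and for some `j`: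
     `sᵢ ≈ bᵢ` for `i < j`, `s_j ≻_k b_j`, and `sᵢ (≻_k ∪ ≈) bᵢ` for `i > j` -/
  | lst {ss : List (Tm F)} {bs : List (List (Tm F))} {j : ℕ} :
      bs.length = ss.length → j < ss.length →
      (∀ i, i < j → ∃ t, bs.getD i [] = [t] ∧ TmEq P (ss.getD i default) t) →
      Epo P D k [ss.getD j default] (bs.getD j []) →
      (∀ i, j < i → i < ss.length → EpoEq P D k [ss.getD i default] (bs.getD i [])) →
      Epo P D k ss bs.flatten
  /- (5) `a = f(s₁,…,s_m)`, `b = g(t₁,…,t_n)` with `n ≤ k`, `f ∼ g` both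
     defined, and for some `j ≤ min(m,n)`: `sᵢ ≈ tᵢ` for `i < j`, `s_j` is a
     strict superterm mod `≈` of `t_j`, and `a` is a strict superterm mod `≈`
     of `tᵢ` for `i > j` -/
  | equiv {f g : F} {ss ts : List (Tm F)} {j : ℕ} :
      D f = true → D g = true → P.equiv f g → ts.length ≤ k →
      j < ss.length → j < ts.length →
      (∀ i, i < j → TmEq P (ss.getD i default) (ts.getD i default)) →
      StrictSup P (ss.getD j default) (ts.getD j default) →
      (∀ i, j < i → i < ts.length → StrictSup P (Tm.fn f ss) (ts.getD i default)) →
      Epo P D k [Tm.fn f ss] [Tm.fn g ts]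

/-- `≻_k ∪ ≈` (terms identified with singleton sequences). -/
inductive EpoEq {F} (P : Precedence F) (D : F → Bool) (k : ℕ) :
    List (Tm F) → List (Tm F) → Prop
  | epo {a b} : Epo P D k a b → EpoEq P D k a b
  | eq {s t : Tm F} : TmEq P s t → EpoEq P D k [s] [t]
end

/-- Constructor terms: terms built from constructors and variables only. -/
inductive IsCtorTerm {F} (D : F → Bool) : Tm F → Prop
  | var (v) : IsCtorTerm D (.var v)
  | fn {f : F} {ts : List (Tm F)} :
      D f = false → (∀ t ∈ ts, IsCtorTerm D t) → IsCtorTerm D (.fn f ts)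

/-- Basic terms: a defined root symbol applied to constructor terms. -/
def Basic {F} (D : F → Bool) (t : Tm F) : Prop :=
  ∃ f ts, t = Tm.fn f ts ∧ D f = true ∧ ∀ s ∈ ts, IsCtorTerm D s

/-- An admissible precedence: every defined symbol is strictly above every
constructor. -/
def Admissible {F} (P : Precedence F) (D : F → Bool) : Prop :=
  ∀ f c, D f = true → D c = false → P.strict f c

/-- A safe mapping is represented by `nrm : F → ℕ`: the first `nrm f` argument
positions of `f` are the normal ones, the remaining positions are the safe
ones.  For constructors all argument positions must be safe. -/
def CtorsAllSafe {F} (D : F → Bool) (nrm : F → ℕ) : Prop :=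
  ∀ c, D c = false → nrm c = 0

/-- The equivalence `s ≈s t`: equal terms, or equivalent root symbols with the
same safe/normal separation and pointwise `≈s`-equivalent arguments. -/
inductive SEq {F} (P : Precedence F) (nrm : F → ℕ) : Tm F → Tm F → Prop
  | refl (t) : SEq P nrm t t
  | fn {f g : F} {ss ts : List (Tm F)} :
      P.equiv f g → nrm f = nrm g → ss.length = ts.length →
      (∀ i, i < ss.length → SEq P nrm (ss.getD i default) (ts.getD i default)) →
      SEq P nrm (.fn f ss) (.fn g ts)

/-- `s` is a strict superterm of `t` modulo `≈s`. -/
inductive SSupS {F} (P : Precedence F) (nrm : F → ℕ) : Tm F → Tm F → Prop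
  | here {f : F} {ss : List (Tm F)} {s t : Tm F} :
      s ∈ ss → SEq P nrm s t → SSupS P nrm (.fn f ss) t
  | there {f : F} {ss : List (Tm F)} {s t : Tm F} :
      s ∈ ss → SSupS P nrm s t → SSupS P nrm (.fn f ss) t

mutual
/-- The auxiliary order `s ⊐ t` (Definition 4.1): descend through an argument,
which must be at a normal position whenever the root symbol is defined. -/
inductive SubEpo {F} (P : Precedence F) (D : F → Bool) (nrm : F → ℕ) :
    Tm F → Tm F → Prop
  | intro {f : F} {ss : List (Tm F)} {t : Tm F} {i : ℕ} :
      i < ss.length → (D f = true → i < nrm f) →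
      SubEpoEq P D nrm (ss.getD i default) t →
      SubEpo P D nrm (.fn f ss) t

/-- `⊐ ∪ ≈s`. -/
inductive SubEpoEq {F} (P : Precedence F) (D : F → Bool) (nrm : F → ℕ) :
    Tm F → Tm F → Prop
  | sub {s t} : SubEpo P D nrm s t → SubEpoEq P D nrm s t
  | eq {s t} : SEq P nrm s t → SubEpoEq P D nrm s t
end

mutual
/-- The exponential path order `s ≻epo* t` (Definition 4.2), w.r.t. a
precedence `P`, defined symbols `D` and safe mapping `nrm` (the first `nrm f`
argument positions of `f` are its normal positions). -/
inductive EpoStar {F} (P : Precedence F) (D : F → Bool) (nrm : F → ℕ) :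
    Tm F → Tm F → Prop
  /- (1) `sᵢ (≻epo* ∪ ≈s) t` for some argument `sᵢ` -/
  | arg {f : F} {ss : List (Tm F)} {t : Tm F} {i : ℕ} :
      i < ss.length →
      EpoStarEq P D nrm (ss.getD i default) t →
      EpoStar P D nrm (.fn f ss) t
  /- (2) `t = g(t₁,…,t_k;t_{k+1},…,t_{k+n})`, `f ≻ g`, `s ⊐ t_j` for normal
     positions `j` and `s ≻epo* t_j` for safe positions `j` -/
  | prec {f g : F} {ss ts : List (Tm F)} :
      P.strict f g →
      (∀ j, j < nrm g → j < ts.length → SubEpo P D nrm (.fn f ss) (ts.getD j default)) →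
      (∀ j, nrm g ≤ j → j < ts.length → EpoStar P D nrm (.fn f ss) (ts.getD j default)) →
      EpoStar P D nrm (.fn f ss) (.fn g ts)
  /- (3) `t = g(t₁,…,t_k;t_{k+1},…,t_{k+n})`, `f ∼ g`, a lexicographic descent
     at some normal position `i ≤ min(l,k)`, and `s ≻epo* t_j` for safe `j` -/
  | equiv {f g : F} {ss ts : List (Tm F)} {i : ℕ} :
      P.equiv f g → i < nrm f → i < nrm g → i < ss.length → i < ts.length →
      (∀ i', i' < i → SEq P nrm (ss.getD i' default) (ts.getD i' default)) →
      SubEpo P D nrm (ss.getD i default) (ts.getD i default) →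
      (∀ j, i < j → j < nrm g → j < ts.length → SubEpo P D nrm (.fn f ss) (ts.getD j default)) →
      (∀ j, nrm g ≤ j → j < ts.length → EpoStar P D nrm (.fn f ss) (ts.getD j default)) →
      EpoStar P D nrm (.fn f ss) (.fn g ts)

/-- `≻epo* ∪ ≈s`. -/
inductive EpoStarEq {F} (P : Precedence F) (D : F → Bool) (nrm : F → ℕ) :
    Tm F → Tm F → Prop
  | epo {s t} : EpoStar P D nrm s t → EpoStarEq P D nrm s t
  | eq {s t} : SEq P nrm s t → EpoStarEq P D nrm s t
end

/-- Application of a substitution `σ : V → T(F,V)` to a term. -/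
def subst {F} (σ : ℕ → Tm F) : Tm F → Tm F
  | .var v => σ v
  | .fn f ts => .fn f (ts.attach.map fun t => subst σ t.1)
decreasing_by have := List.sizeOf_lt_of_mem t.2; simp_wf; omega

/-- The variable `v` occurs in the term. -/
inductive VarIn {F} (v : ℕ) : Tm F → Prop
  | var : VarIn v (.var v)
  | fn {f : F} {ts : List (Tm F)} {t : Tm F} : t ∈ ts → VarIn v t → VarIn v (.fn f ts)

/-- A term rewrite system: left-hand sides are not variables and all variables
of a right-hand side occur in the corresponding left-hand side. -/
def IsTRS {F} (R : Set (Tm F × Tm F)) : Prop :=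
  ∀ lr ∈ R, (∀ v, lr.1 ≠ Tm.var v) ∧ (∀ v, VarIn v lr.2 → VarIn v lr.1)

/-- A constructor TRS: all left-hand sides are basic terms. -/
def ConstructorTRS {F} (D : F → Bool) (R : Set (Tm F × Tm F)) : Prop :=
  ∀ lr ∈ R, Basic D lr.1

/-- The rewrite relation `→_R` induced by `R`. -/
inductive Rew {F} (R : Set (Tm F × Tm F)) : Tm F → Tm F → Prop
  | root {l r : Tm F} {σ : ℕ → Tm F} :
      (l, r) ∈ R → Rew R (subst σ l) (subst σ r)
  | congr {f : F} {pre post : List (Tm F)} {s t : Tm F} :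
      Rew R s t → Rew R (.fn f (pre ++ s :: post)) (.fn f (pre ++ t :: post))

/-- `t` is an `R`-normal form. -/
def NFo {F} (R : Set (Tm F × Tm F)) (t : Tm F) : Prop := ∀ u, ¬ Rew R t u

/-- The innermost rewrite relation `i→_R`: contracted redexes have all their
proper subterms in normal form. -/
inductive IRew {F} (R : Set (Tm F × Tm F)) : Tm F → Tm F → Prop
  | root {l r : Tm F} {σ : ℕ → Tm F} :
      (l, r) ∈ R →
      (∀ f us, subst σ l = Tm.fn f us → ∀ u ∈ us, NFo R u) →
      IRew R (subst σ l) (subst σ r)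
  | congr {f : F} {pre post : List (Tm F)} {s t : Tm F} :
      IRew R s t → IRew R (.fn f (pre ++ s :: post)) (.fn f (pre ++ t :: post))

/-- `R` is completely defined: no defined symbol occurs in any normal form. -/
def CompletelyDefined {F} (D : F → Bool) (R : Set (Tm F × Tm F)) : Prop :=
  ∀ t, NFo R t → IsCtorTerm D t

/-- `Steps r n s t`: a derivation of length `n` from `s` to `t`. -/
def Steps {α} (r : α → α → Prop) : ℕ → α → α → Prop
  | 0, s, t => s = t
  | n + 1, s, t => ∃ u, r s u ∧ Steps r n u t

/-- The innermost runtime complexity `rc^i_R(n)`: the supremum (in `ℕ∞`) of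
the lengths of innermost derivations starting from basic terms of size at
most `n`. -/
noncomputable def rcI {F} (D : F → Bool) (R : Set (Tm F × Tm F)) (n : ℕ) : ℕ∞ :=
  sSup {m : ℕ∞ | ∃ (k : ℕ) (t u : Tm F),
    m = (k : ℕ∞) ∧ Basic D t ∧ t.size ≤ n ∧ Steps (IRew R) k t u}

/-- The set `Tn`: constructor terms, and terms whose normal arguments are
constructor terms and whose safe arguments are again in `Tn`. -/
inductive TnSet {F} (D : F → Bool) (nrm : F → ℕ) : Tm F → Prop
  | ctor {t : Tm F} : IsCtorTerm D t → TnSet D nrm t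
  | fn {f : F} {ts : List (Tm F)} :
      (∀ i, i < nrm f → i < ts.length → IsCtorTerm D (ts.getD i default)) →
      (∀ i, nrm f ≤ i → i < ts.length → TnSet D nrm (ts.getD i default)) →
      TnSet D nrm (.fn f ts)

/-- Renaming of function symbols in a term. -/
def Tm.mapSym {F G} (h : F → G) : Tm F → Tm G
  | .var v => .var v
  | .fn f ts => .fn (h f) (ts.attach.map fun t => t.1.mapSym h)
decreasing_by have := List.sizeOf_lt_of_mem t.2; simp_wf; omega

/-- Whether a term is a constructor term, as a Boolean predicate. -/
def ctorB {F} (D : F → Bool) : Tm F → Bool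
  | .var _ => true
  | .fn f ts => !(D f) && ts.attach.all fun t => ctorB D t.1
decreasing_by have := List.sizeOf_lt_of_mem t.2; simp_wf; omega

/-- The extension of a precedence to the marked signature `F ⊕ F` (`Sum.inl f`
is the original symbol `f`, `Sum.inr f` is the marked symbol `fⁿ`):
`fⁿ ∼ gⁿ` iff `f ∼ g` and `fⁿ ≻ gⁿ` iff `f ≻ g` (constructors are shared). -/
def Precedence.lift {F} (P : Precedence F) : Precedence (F ⊕ F) where
  le a b := P.le (Sum.elim id id a) (Sum.elim id id b)
  refl _ := P.refl _
  trans h1 h2 := P.trans h1 h2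
  wf := InvImage.wf (Sum.elim id id) P.wf

/-- Defined symbols of the marked signature: the marked symbols `fⁿ` are the
defined ones. -/
def liftD {F} (D : F → Bool) : F ⊕ F → Bool := Sum.elim D (fun _ => true)

/-- The predicative interpretation `N` (Definition 4.4), mapping terms to
finite sequences of terms over the marked signature: `N(t) = []` for
constructor terms `t`, and otherwise
`N(f(t₁,…,t_k;t_{k+1},…,t_{k+n})) = [fⁿ(t₁,…,t_k)] ++ N(t_{k+1}) ++ ⋯ ++ N(t_{k+n})`. -/
def NI {F} (D : F → Bool) (nrm : F → ℕ) : Tm F → List (Tm (F ⊕ F))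
  | .var _ => []
  | .fn f ts =>
      if ctorB D (.fn f ts) then []
      else Tm.fn (Sum.inr f) ((ts.take (nrm f)).map (Tm.mapSym Sum.inl)) ::
        ((ts.attach.map fun t => NI D nrm t.1).drop (nrm f)).flatten
decreasing_by have := List.sizeOf_lt_of_mem t.2; simp_wf; omega

/-- One-hole contexts. -/
inductive Ctx (F : Type) : Type
  | hole : Ctx F
  | fn : F → List (Tm F) → Ctx F → List (Tm F) → Ctx F

/-- Filling the hole of a context with a term. -/
def Ctx.fill {F} : Ctx F → Tm F → Tm F
  | .hole, t => t
  | .fn f pre C post, t => .fn f (pre ++ C.fill t :: post)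

theorem Tm.induction_mem {F : Type} {p : Tm F → Prop} (var : ∀ v, p (.var v))
    (fn : ∀ f ts, (∀ t ∈ ts, p t) → p (.fn f ts)) : ∀ t, p t
  | .var v => var v
  | .fn f ts => fn f ts fun t _ => Tm.induction_mem var fn t

theorem List.getD_map_of_lt {α β : Type*} (f : α → β) {l : List α} {i : ℕ} (d : α) (e : β)
    (h : i < l.length) : (l.map f).getD i e = f (l.getD i d) := by
  simp [h]

theorem List.getD_mem_of_lt {α : Type*} {l : List α} {i : ℕ} (d : α) (h : i < l.length) :
    l.getD i d ∈ l := by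
  simp [h]

theorem List.exists_lt_getD_eq_of_mem {α : Type*} {l : List α} {a : α} (d : α) (h : a ∈ l) :
    ∃ i, i < l.length ∧ l.getD i d = a := by
  obtain ⟨i, hi, rfl⟩ := List.mem_iff_getElem.1 h
  exact ⟨i, hi, List.getD_eq_getElem _ _ hi⟩

theorem List.getD_take_of_lt {α : Type*} {l : List α} {i n : ℕ} (d : α) (h : i < n)
    (h' : i < l.length) : (l.take n).getD i d = l.getD i d := by
  simp [h, h']

theorem Tm.size_fn {F : Type} (f : F) (ts : List (Tm F)) :
    (Tm.fn f ts).size = 1 + (ts.map Tm.size).sum := by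
  simp [Tm.size]

theorem Tm.one_le_size {F : Type} (t : Tm F) : 1 ≤ t.size := by
  cases t <;> simp [Tm.size]

theorem Tm.length_lt_size_fn {F : Type} (f : F) (ts : List (Tm F)) :
    ts.length < (Tm.fn f ts).size := by
  have h : (ts.map Tm.size).length * 1 ≤ (ts.map Tm.size).sum := by
    simpa using List.card_nsmul_le_sum (ts.map Tm.size) 1 fun n hn => by
      obtain ⟨t, -, rfl⟩ := List.mem_map.1 hn
      exact t.one_le_size
  rw [Tm.size_fn]
  simp only [List.length_map, mul_one] at h
  omega

theorem Tm.size_lt_size_fn {F : Type} (f : F) {ts : List (Tm F)} {t : Tm F} (h : t ∈ ts) :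
    t.size < (Tm.fn f ts).size := by
  have := List.single_le_sum (l := ts.map Tm.size) (by simp) _ (List.mem_map_of_mem h)
  rw [Tm.size_fn]
  omega

theorem subst_fn {F : Type} (σ : ℕ → Tm F) (f : F) (ts : List (Tm F)) :
    subst σ (.fn f ts) = .fn f (ts.map (subst σ)) := by
  simp [subst]

theorem Tm.mapSym_fn {F G : Type} (h : F → G) (f : F) (ts : List (Tm F)) :
    (Tm.fn f ts).mapSym h = .fn (h f) (ts.map (Tm.mapSym h)) := by
  simp [Tm.mapSym]

theorem ctorB_fn {F : Type} (D : F → Bool) (f : F) (ts : List (Tm F)) :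
    ctorB D (.fn f ts) = (!(D f) && ts.all (ctorB D)) := by
  simp [ctorB]

theorem NI_fn {F : Type} (D : F → Bool) (nrm : F → ℕ) (f : F) (ts : List (Tm F)) :
    NI D nrm (.fn f ts) = if ctorB D (.fn f ts) then []
      else Tm.fn (Sum.inr f) ((ts.take (nrm f)).map (Tm.mapSym Sum.inl)) ::
        ((ts.drop (nrm f)).map (NI D nrm)).flatten := by
  simp [NI]

theorem IsCtorTerm.ctorB_eq_true {F : Type} {D : F → Bool} {t : Tm F} (h : IsCtorTerm D t) :
    ctorB D t = true := by
  induction h with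
  | var v => simp [ctorB]
  | fn hf _ ih => simpa [ctorB_fn, hf] using ih

theorem IsCtorTerm.NI_eq_nil {F : Type} {D : F → Bool} (nrm : F → ℕ) {t : Tm F}
    (h : IsCtorTerm D t) : NI D nrm t = [] := by
  cases t with
  | var v => simp [NI]
  | fn f ts => rw [NI_fn, if_pos h.ctorB_eq_true]

theorem IsCtorTerm.subst {F : Type} {D : F → Bool} {σ : ℕ → Tm F}
    (hσ : ∀ v, IsCtorTerm D (σ v)) {t : Tm F} (h : IsCtorTerm D t) :
    IsCtorTerm D (subst σ t) := by
  induction h with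
  | var v => simpa [_root_.subst] using hσ v
  | fn hf _ ih =>
    rw [subst_fn]
    exact .fn hf (by simpa using ih)

theorem IsCtorTerm.symbol_not_defined {F : Type} {D : F → Bool} {f : F} {ts : List (Tm F)}
    (h : IsCtorTerm D (.fn f ts)) : D f = false := by
  cases h; assumption

theorem IsCtorTerm.getD {F : Type} {D : F → Bool} {f : F} {ts : List (Tm F)} {i : ℕ}
    (h : IsCtorTerm D (.fn f ts)) (hi : i < ts.length) : IsCtorTerm D (ts.getD i default) := by
  cases h with
  | fn _ h => exact h _ (List.getD_mem_of_lt _ hi)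

/-- A symbol below a constructor is a constructor. -/
theorem Admissible.not_defined_of_le {F : Type} {P : Precedence F} {D : F → Bool}
    (hadm : Admissible P D) {f g : F} (hf : D f = false) (h : P.le f g) : D g = false := by
  by_contra hg
  exact (hadm g f (by simpa using hg) hf).2 h

theorem SEq.isCtorTerm {F : Type} {P : Precedence F} {D : F → Bool} {nrm : F → ℕ}
    (hadm : Admissible P D) {s t : Tm F} (h : SEq P nrm s t) (hs : IsCtorTerm D s) :
    IsCtorTerm D t := by
  induction h with
  | refl t => exact hs
  | fn hfg _ hlen _ ih =>
    refine .fn (hadm.not_defined_of_le hs.symbol_not_defined hfg.1) fun t ht => ?_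
    obtain ⟨i, hi, rfl⟩ := List.exists_lt_getD_eq_of_mem default ht
    exact ih i (hlen ▸ hi) (hs.getD (hlen ▸ hi))

mutual
theorem EpoStar.isCtorTerm {F : Type} {P : Precedence F} {D : F → Bool} {nrm : F → ℕ}
    (hadm : Admissible P D) (hsafe : CtorsAllSafe D nrm) {s t : Tm F}
    (h : EpoStar P D nrm s t) (hs : IsCtorTerm D s) : IsCtorTerm D t :=
  match h with
  | .arg hi h => EpoStarEq.isCtorTerm hadm hsafe h (hs.getD hi)
  | .prec hfg _ hsafeArgs => by
    have hg := hadm.not_defined_of_le hs.symbol_not_defined hfg.1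
    refine .fn hg fun t ht => ?_
    obtain ⟨i, hi, rfl⟩ := List.exists_lt_getD_eq_of_mem default ht
    exact EpoStar.isCtorTerm hadm hsafe (hsafeArgs i (by simp [hsafe _ hg]) hi) hs
  | .equiv _ hi _ _ _ _ _ _ _ => by
    simp [hsafe _ hs.symbol_not_defined] at hi

theorem EpoStarEq.isCtorTerm {F : Type} {P : Precedence F} {D : F → Bool} {nrm : F → ℕ}
    (hadm : Admissible P D) (hsafe : CtorsAllSafe D nrm) {s t : Tm F}
    (h : EpoStarEq P D nrm s t) (hs : IsCtorTerm D s) : IsCtorTerm D t :=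
  match h with
  | .epo h => EpoStar.isCtorTerm hadm hsafe h hs
  | .eq h => SEq.isCtorTerm hadm h hs
end

theorem SEq.tmEq_mapSym_subst {F : Type} {P : Precedence F} {nrm : F → ℕ} (σ : ℕ → Tm F)
    {s t : Tm F} (h : SEq P nrm s t) :
    TmEq P.lift ((subst σ s).mapSym Sum.inl) ((subst σ t).mapSym Sum.inl) := by
  induction h with
  | refl t => exact .refl _
  | fn hfg _ hlen _ ih =>
    simp only [subst_fn, Tm.mapSym_fn, List.map_map]
    refine .fn hfg (by simpa using hlen) fun i hi => ?_
    rw [List.length_map] at hi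
    rw [List.getD_map_of_lt _ default _ hi, List.getD_map_of_lt _ default _ (hlen ▸ hi)]
    exact ih i hi

theorem StrictSup.of_mem {F : Type} {P : Precedence F} {D : F → Bool} {nrm : F → ℕ}
    {σ : ℕ → Tm F} {f : F ⊕ F} {us : List (Tm (F ⊕ F))} {s t : Tm F}
    (hmem : (subst σ s).mapSym Sum.inl ∈ us)
    (hsub : SubEpo P D nrm s t →
      StrictSup P.lift ((subst σ s).mapSym Sum.inl) ((subst σ t).mapSym Sum.inl))
    (h : SubEpoEq P D nrm s t) :
    StrictSup P.lift (.fn f us) ((subst σ t).mapSym Sum.inl) := by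
  cases h with
  | sub h => exact .there hmem (hsub h)
  | eq h => exact .here hmem (h.tmEq_mapSym_subst σ)

theorem SubEpo.strictSup_mapSym_subst {F : Type} {P : Precedence F} {D : F → Bool}
    {nrm : F → ℕ} (σ : ℕ → Tm F) {s t : Tm F} (h : SubEpo P D nrm s t) :
    StrictSup P.lift ((subst σ s).mapSym Sum.inl) ((subst σ t).mapSym Sum.inl) := by
  induction s using Tm.induction_mem with
  | var v => cases h
  | fn f ss ih =>
    obtain ⟨hi, -, h⟩ := h
    have hmem := List.getD_mem_of_lt default hi
    simp only [subst_fn, Tm.mapSym_fn, List.map_map]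
    exact .of_mem (List.mem_map_of_mem (f := Tm.mapSym Sum.inl ∘ subst σ) hmem) (ih _ hmem) h

/-- The marked term heading `NI D nrm (subst σ (f ts))`. -/
def markedSubst {F : Type} (nrm : F → ℕ) (σ : ℕ → Tm F) (f : F) (ts : List (Tm F)) :
    Tm (F ⊕ F) :=
  .fn (Sum.inr f) ((ts.take (nrm f)).map fun t => (subst σ t).mapSym Sum.inl)

theorem NI_subst_fn {F : Type} (D : F → Bool) (nrm : F → ℕ) (σ : ℕ → Tm F) (f : F)
    (ts : List (Tm F)) :
    NI D nrm (subst σ (.fn f ts)) = if ctorB D (subst σ (.fn f ts)) then []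
      else markedSubst nrm σ f ts ::
        ((ts.drop (nrm f)).map fun t => NI D nrm (subst σ t)).flatten := by
  simp only [subst_fn, NI_fn, markedSubst, ← List.map_take, ← List.map_drop, List.map_map,
    Function.comp_def]

theorem NI_subst_of_basic {F : Type} {D : F → Bool} (nrm : F → ℕ) {σ : ℕ → Tm F}
    (hσ : ∀ v, IsCtorTerm D (σ v)) {f : F} {ss : List (Tm F)} (hf : D f = true)
    (hss : ∀ s ∈ ss, IsCtorTerm D s) :
    NI D nrm (subst σ (.fn f ss)) = [markedSubst nrm σ f ss] := by
  have hctor : ctorB D (subst σ (.fn f ss)) = false := by simp [subst_fn, ctorB_fn, hf]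
  rw [NI_subst_fn, if_neg (by simp [hctor])]
  simp only [List.cons.injEq, true_and, List.flatten_eq_nil_iff, List.mem_map]
  rintro _ ⟨s, hs, rfl⟩
  exact ((hss s (List.mem_of_mem_drop hs)).subst hσ).NI_eq_nil nrm

theorem length_NI_subst_le_size {F : Type} {D : F → Bool} (nrm : F → ℕ) {σ : ℕ → Tm F}
    (hσ : ∀ v, IsCtorTerm D (σ v)) (t : Tm F) :
    (NI D nrm (subst σ t)).length ≤ t.size := by
  induction t using Tm.induction_mem with
  | var v => simp [subst, (hσ v).NI_eq_nil nrm]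
  | fn f ts ih =>
    rw [NI_subst_fn]
    split_ifs
    · simp
    · rw [List.length_cons, Tm.size_fn, List.length_flatten, List.map_map, add_comm]
      gcongr
      calc ((ts.drop (nrm f)).map (List.length ∘ fun t => NI D nrm (subst σ t))).sum
          ≤ ((ts.drop (nrm f)).map Tm.size).sum :=
            List.sum_le_sum fun t ht => ih t (List.mem_of_mem_drop ht)
        _ ≤ (ts.map Tm.size).sum :=
            ((List.drop_sublist _ _).map _).sum_le_sum (by simp)

theorem SubEpo.strictSup_markedSubst {F : Type} {P : Precedence F} {D : F → Bool} {nrm : F → ℕ}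
    (σ : ℕ → Tm F) {f : F} {ss : List (Tm F)} {t : Tm F} (hf : D f = true)
    (h : SubEpo P D nrm (.fn f ss) t) :
    StrictSup P.lift (markedSubst nrm σ f ss) ((subst σ t).mapSym Sum.inl) := by
  obtain ⟨hi, hnrm, h⟩ := h
  rw [← List.getD_take_of_lt default (hnrm hf) hi] at h
  refine .of_mem (List.mem_map_of_mem (f := fun t => (subst σ t).mapSym Sum.inl) ?_)
    (fun h => h.strictSup_mapSym_subst σ) h
  exact List.getD_mem_of_lt _ (by simp [hnrm hf, hi])

/-- A list of terms that are all below `f ss` is itself below `f ss`. -/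
theorem Epo.of_forall_mem {F : Type} {P : Precedence F} {D : F → Bool} {k : ℕ} {f : F}
    {ss ts : List (Tm F)} (hf : D f = true) (hlen : ts.length ≤ k)
    (h : ∀ t ∈ ts, Epo P D k [.fn f ss] [t]) : Epo P D k [.fn f ss] ts := by
  match ts, hlen, h with
  | [], _, h => exact .seq hf (.inl rfl) h
  | [t], _, h => exact h t (by simp)
  | _ :: _ :: _, hlen, h => exact .seq hf (.inr ⟨by simp, hlen⟩) h

theorem EpoStar.epo_markedSubst_of_mem_NI {F : Type} {P : Precedence F} {D : F → Bool}
    {nrm : F → ℕ} (hadm : Admissible P D) (hsafe : CtorsAllSafe D nrm) {σ : ℕ → Tm F}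
    (hσ : ∀ v, IsCtorTerm D (σ v)) {f : F} {ss : List (Tm F)} (hf : D f = true)
    (hss : ∀ s ∈ ss, IsCtorTerm D s) {k : ℕ} {t : Tm F} (h : EpoStar P D nrm (.fn f ss) t)
    (hk : t.size ≤ k) :
    ∀ u ∈ NI D nrm (subst σ t), Epo P.lift (liftD D) k [markedSubst nrm σ f ss] [u] := by
  induction t using Tm.induction_mem with
  | var v => simp [subst, (hσ v).NI_eq_nil nrm]
  | fn g ts ih =>
    have ih_safe (hsafeArgs : ∀ j, nrm g ≤ j → j < ts.length →
        EpoStar P D nrm (.fn f ss) (ts.getD j default))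
        (hhead : Epo P.lift (liftD D) k [markedSubst nrm σ f ss] [markedSubst nrm σ g ts]) :
        ∀ u ∈ NI D nrm (subst σ (.fn g ts)),
          Epo P.lift (liftD D) k [markedSubst nrm σ f ss] [u] := by
      rw [NI_subst_fn]
      split_ifs
      · simp
      · simp only [List.mem_cons, List.mem_flatten, List.mem_map]
        rintro u (rfl | ⟨_, ⟨t, ht, rfl⟩, hu⟩)
        · exact hhead
        · have hmem := List.mem_of_mem_drop ht
          obtain ⟨j, hj, rfl⟩ := List.exists_lt_getD_eq_of_mem default ht
          refine ih _ hmem ?_ ((Tm.size_lt_size_fn g hmem).le.trans hk) u hu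
          rw [List.length_drop] at hj
          have := hsafeArgs (nrm g + j) (by omega) (by omega)
          simpa [List.getD_eq_getElem?_getD] using this
    have hlen : ((ts.take (nrm g)).map
        fun t => (subst σ t).mapSym (Sum.inl : F → F ⊕ F)).length ≤ k := by
      have := Tm.length_lt_size_fn g ts
      simp only [List.length_map, List.length_take]
      omega
    have getD_marked {h : F} {us : List (Tm F)} {j : ℕ} (hj : j < nrm h) (hj' : j < us.length) :
        ((us.take (nrm h)).map fun t => (subst σ t).mapSym (Sum.inl : F → F ⊕ F)).getD j default
          = (subst σ (us.getD j default)).mapSym Sum.inl := by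
      rw [List.getD_map_of_lt _ default _ (by simp [hj, hj']), List.getD_take_of_lt _ hj hj']
    cases h with
    | arg hi h =>
      have := (h.isCtorTerm hadm hsafe (hss _ (List.getD_mem_of_lt _ hi))).subst hσ
      simp [this.NI_eq_nil nrm]
    | prec hfg hnormal hsafeArgs =>
      refine ih_safe hsafeArgs (.prec rfl hfg hlen fun u hu => ?_)
      obtain ⟨t, ht, rfl⟩ := List.mem_map.1 hu
      obtain ⟨j, hj, rfl⟩ := List.exists_lt_getD_eq_of_mem default ht
      simp only [List.length_take, lt_min_iff] at hj
      rw [List.getD_take_of_lt _ hj.1 hj.2]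
      exact (hnormal j hj.1 hj.2).strictSup_markedSubst σ hf
    | @equiv _ _ _ _ i hfg hif hig his hit heq hsub hnormal hsafeArgs =>
      refine ih_safe hsafeArgs (.equiv (j := i) rfl rfl hfg hlen (by simp [hif, his])
        (by simp [hig, hit]) (fun j hj => ?_) ?_ fun j hj hj' => ?_)
      · rw [getD_marked (hj.trans hif) (hj.trans his), getD_marked (hj.trans hig) (hj.trans hit)]
        exact (heq j hj).tmEq_mapSym_subst σ
      · rw [getD_marked hif his, getD_marked hig hit]
        exact hsub.strictSup_mapSym_subst σ
      · simp only [List.length_map, List.length_take, lt_min_iff] at hj'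
        rw [getD_marked hj'.1 hj'.2]
        exact (hnormal j hj hj'.1 hj'.2).strictSup_markedSubst σ hf

/-- Lemma 4.11: for a basic term `s` and a substitution `σ` into constructor
terms, `s ≻epo* t` implies `N(sσ) ≻_{|t|} N(tσ)`. -/
theorem epostar_embed_root {F : Type} (P : Precedence F) (D : F → Bool)
    (nrm : F → ℕ) (hadm : Admissible P D) (hsafe : CtorsAllSafe D nrm)
    (s t : Tm F) (hs : Basic D s)
    (σ : ℕ → Tm F) (hσ : ∀ v, IsCtorTerm D (σ v))
    (h : EpoStar P D nrm s t) :
    Epo (Precedence.lift P) (liftD D) t.size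
      (NI D nrm (subst σ s)) (NI D nrm (subst σ t)) := by
  obtain ⟨f, ss, rfl, hf, hss⟩ := hs
  rw [NI_subst_of_basic nrm hσ hf hss]
  exact .of_forall_mem rfl (length_NI_subst_le_size nrm hσ t)
    (h.epo_markedSubst_of_mem_NI hadm hsafe hσ hf hss le_rfl)
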